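/- arXiv:2304.05648 — 2 statements merged into one kernel-verified Lean document; each statement's English description precedes it below -/
import Mathlib

section
/- Let M ≥ 1 be an integer, β, τ₁, τ₀ > 0, ε₁ > 0, ε₂ ≥ 0, and let a, b ∈ ℂ^M satisfy ε₁ + ε₂ − ε₂ Φ₂(b) > 0. Then the log-likelihood ratio test threshold takes the form: (ε₁+ε₂) / (Φ₂(b) · (ε₁ Φ₁(a) + ε₂)) ≥ 1 if and only if ‖a‖² ≥ [M · ln(1 + β/τ₁²) + ln( ε₁ Φ₂(b) / (ε₁ + ε₂ − ε₂ Φ₂(b)) )] / (1/τ₁² − 1/(τ₁² + β)). -/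
open scoped BigOperators

/-- Squared Euclidean norm of a vector in ℂ^M. -/
noncomputable def nsq {M : ℕ} (x : Fin M → ℂ) : ℝ := ∑ i, Complex.normSq (x i)

/-- Φ₁(a) = f_{τ₁²}(a)/f_{β+τ₁²}(a). -/
noncomputable def Phi1 (M : ℕ) (β τ₁ : ℝ) (a : Fin M → ℂ) : ℝ :=
  ((β + τ₁ ^ 2) / τ₁ ^ 2) ^ M * Real.exp ((1 / (β + τ₁ ^ 2) - 1 / τ₁ ^ 2) * nsq a)

/-- Φ₂(b) = f_{τ₀²}(b)/f_{β+τ₀²}(b). -/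
noncomputable def Phi2 (M : ℕ) (β τ₀ : ℝ) (b : Fin M → ℂ) : ℝ :=
  ((β + τ₀ ^ 2) / τ₀ ^ 2) ^ M * Real.exp ((1 / (β + τ₀ ^ 2) - 1 / τ₀ ^ 2) * nsq b)

theorem Phi1_pos {M : ℕ} {β τ : ℝ} (hβ : 0 < β) (hτ : 0 < τ) (x : Fin M → ℂ) :
    0 < Phi1 M β τ x := by
  unfold Phi1
  positivity

theorem Phi2_pos {M : ℕ} {β τ : ℝ} (hβ : 0 < β) (hτ : 0 < τ) (x : Fin M → ℂ) :
    0 < Phi2 M β τ x :=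
  Phi1_pos hβ hτ x

theorem log_Phi1 {M : ℕ} {β τ : ℝ} (hβ : 0 < β) (hτ : 0 < τ) (x : Fin M → ℂ) :
    Real.log (Phi1 M β τ x) =
      M * Real.log (1 + β / τ ^ 2) - nsq x * (1 / τ ^ 2 - 1 / (τ ^ 2 + β)) := by
  have hbase : (β + τ ^ 2) / τ ^ 2 = 1 + β / τ ^ 2 := by
    field_simp
    ring
  unfold Phi1
  rw [Real.log_mul (by positivity) (Real.exp_ne_zero _), Real.log_pow, Real.log_exp, hbase,
    add_comm β]
  ring

/-- The log-likelihood ratio test of the correlated AMP receiver: the likelihood ratio is at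
least one iff the squared norm of the current AMP statistic exceeds the activity-detection
threshold l_r. -/
theorem correlated_amp_llr_threshold
    (M : ℕ) (hM : 1 ≤ M) (β τ₁ τ₀ : ℝ) (hβ : 0 < β) (hτ₁ : 0 < τ₁) (hτ₀ : 0 < τ₀)
    (ε₁ ε₂ : ℝ) (hε₁ : 0 < ε₁) (hε₂ : 0 ≤ ε₂)
    (a b : Fin M → ℂ)
    (hpos : 0 < ε₁ + ε₂ - ε₂ * Phi2 M β τ₀ b) :
    (ε₁ + ε₂) / (Phi2 M β τ₀ b * (ε₁ * Phi1 M β τ₁ a + ε₂)) ≥ 1 ↔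
      nsq a ≥
        (M * Real.log (1 + β / τ₁ ^ 2) +
            Real.log (ε₁ * Phi2 M β τ₀ b / (ε₁ + ε₂ - ε₂ * Phi2 M β τ₀ b))) /
          (1 / τ₁ ^ 2 - 1 / (τ₁ ^ 2 + β)) := by
  have h1 := Phi1_pos hβ hτ₁ a
  have h2 := Phi2_pos hβ hτ₀ b
  have hc : 0 < 1 / τ₁ ^ 2 - 1 / (τ₁ ^ 2 + β) :=
    sub_pos.2 (one_div_lt_one_div_of_lt (by positivity) (by linarith))
  have hlog := log_Phi1 hβ hτ₁ a
  set p := Phi1 M β τ₁ a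
  set q := Phi2 M β τ₀ b
  have hR : 0 < ε₁ * q / (ε₁ + ε₂ - ε₂ * q) := by positivity
  calc (ε₁ + ε₂) / (q * (ε₁ * p + ε₂)) ≥ 1
      ↔ p * (ε₁ * q / (ε₁ + ε₂ - ε₂ * q)) ≤ 1 := by
        rw [ge_iff_le, one_le_div (by positivity), ← mul_div_assoc, div_le_one hpos]
        constructor <;> intro h <;> linarith
    _ ↔ Real.log p + Real.log (ε₁ * q / (ε₁ + ε₂ - ε₂ * q)) ≤ 0 := by
        rw [← Real.log_mul h1.ne' hR.ne', Real.log_nonpos_iff (by positivity)]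
    _ ↔ _ := by
        rw [ge_iff_le, div_le_iff₀ hc, hlog]
        constructor <;> intro h <;> linarith
end

section
/- Let M ≥ 1 and 1 ≤ r ≤ M be integers, s > 0, and let P ∈ ℂ^{M×M} be a fixed Hermitian idempotent matrix of rank r. If h ∈ ℂ^M is a random vector with i.i.d. CN(0, s²) entries, then h^H P h is almost surely a nonnegative real number, and its law is the Gamma distribution with shape r and scale s². -/
open MeasureTheory ProbabilityTheory Matrix
open scoped BigOperators ENNReal

/-- The complex Gaussian distribution CN(0,v): real and imaginary parts are independent real
Gaussians with mean 0 and variance v/2. -/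
noncomputable def stdCGaussian (v : ℝ) : Measure ℂ :=
  ((gaussianReal 0 (v / 2).toNNReal).prod (gaussianReal 0 (v / 2).toNNReal)).map
    Complex.measurableEquivRealProd.symm

/-- The law of a vector in ℂ^M with i.i.d. CN(0,v) entries. -/
noncomputable def iidCGaussian (M : ℕ) (v : ℝ) : Measure (Fin M → ℂ) :=
  Measure.pi fun _ => stdCGaussian v

lemma integral_stdCGaussian_eq_integral_prod {E : Type*} [NormedAddCommGroup E] [NormedSpace ℝ E]
    (v : ℝ) (f : ℂ → E) :
    ∫ z, f z ∂(stdCGaussian v) =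
      ∫ p : ℝ × ℝ, f ⟨p.1, p.2⟩ ∂((gaussianReal 0 (v / 2).toNNReal).prod
        (gaussianReal 0 (v / 2).toNNReal)) := by
  rw [stdCGaussian, integral_map_equiv]
  rfl

instance isProbabilityMeasure_stdCGaussian (v : ℝ) : IsProbabilityMeasure (stdCGaussian v) :=
  Measure.isProbabilityMeasure_map Complex.measurableEquivRealProd.symm.measurable.aemeasurable

instance isProbabilityMeasure_iidCGaussian (M : ℕ) (v : ℝ) :
    IsProbabilityMeasure (iidCGaussian M v) := by
  unfold iidCGaussian
  infer_instance

lemma charFun_stdCGaussian {v : ℝ} (hv : 0 ≤ v) (t : ℂ) :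
    charFun (stdCGaussian v) t = Complex.exp (-(v / 4 * ‖t‖ ^ 2 : ℝ)) := by
  have key (p : ℝ × ℝ) : Complex.exp ((inner ℝ (⟨p.1, p.2⟩ : ℂ) t : ℝ) * Complex.I)
      = Complex.exp (t.re * p.1 * Complex.I) * Complex.exp (t.im * p.2 * Complex.I) := by
    rw [← Complex.exp_add]
    congr 1
    simp [Complex.inner]
    ring
  rw [charFun_apply, integral_stdCGaussian_eq_integral_prod]
  simp_rw [key]
  rw [integral_prod_mul (fun x : ℝ ↦ Complex.exp (t.re * x * Complex.I))
    (fun y : ℝ ↦ Complex.exp (t.im * y * Complex.I)), ← charFun_apply_real, ← charFun_apply_real,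
    charFun_gaussianReal, charFun_gaussianReal, ← Complex.exp_add]
  congr 1
  rw [← Complex.normSq_eq_norm_sq, Complex.normSq_apply, Real.coe_toNNReal _ (by positivity)]
  push_cast
  ring

lemma charFun_map_toLp_iidCGaussian (M : ℕ) {v : ℝ} (hv : 0 ≤ v) (t : EuclideanSpace ℂ (Fin M)) :
    charFun ((iidCGaussian M v).map (WithLp.toLp 2)) t
      = Complex.exp (-(v / 4 * ‖t‖ ^ 2 : ℝ)) := by
  rw [iidCGaussian, charFun_pi]
  simp_rw [charFun_stdCGaussian hv]
  rw [← Complex.exp_sum, EuclideanSpace.norm_sq_eq, Finset.mul_sum]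
  push_cast
  rw [Finset.sum_neg_distrib]

lemma iidCGaussian_map_mulVec {M : ℕ} {v : ℝ} (hv : 0 ≤ v) {U : Matrix (Fin M) (Fin M) ℂ}
    (hU : U ∈ Matrix.unitaryGroup (Fin M) ℂ) :
    (iidCGaussian M v).map (U *ᵥ ·) = iidCGaussian M v := by
  have hm : Measurable (U *ᵥ · : (Fin M → ℂ) → Fin M → ℂ) := by
    have : Continuous (U *ᵥ · : (Fin M → ℂ) → Fin M → ℂ) := by fun_prop
    exact this.measurable
  have hinner (x y : EuclideanSpace ℂ (Fin M)) :
      inner ℝ x y = (star x.ofLp ⬝ᵥ y.ofLp).re := by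
    simp [PiLp.inner_apply, dotProduct, Complex.inner, mul_comm]
  have : IsProbabilityMeasure ((iidCGaussian M v).map (U *ᵥ ·)) :=
    Measure.isProbabilityMeasure_map hm.aemeasurable
  refine (MeasurableEquiv.toLp 2 (Fin M → ℂ)).map_measurableEquiv_injective
    (Measure.ext_of_charFun (E := EuclideanSpace ℂ (Fin M)) (funext fun t ↦ ?_))
  rw [MeasurableEquiv.coe_toLp]
  have hnorm : ‖(WithLp.toLp 2 (Uᴴ *ᵥ t.ofLp) : EuclideanSpace ℂ (Fin M))‖ ^ 2 = ‖t‖ ^ 2 := by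
    rw [← real_inner_self_eq_norm_sq, ← real_inner_self_eq_norm_sq, hinner, hinner]
    simp only [star_mulVec, conjTranspose_conjTranspose]
    rw [← dotProduct_mulVec, mulVec_mulVec, ← star_eq_conjTranspose,
      Matrix.mem_unitaryGroup_iff.1 hU, one_mulVec]
  have hchar : charFun (((iidCGaussian M v).map (U *ᵥ ·)).map (WithLp.toLp 2)) t
      = charFun ((iidCGaussian M v).map (WithLp.toLp 2))
        (WithLp.toLp 2 (Uᴴ *ᵥ t.ofLp) : EuclideanSpace ℂ (Fin M)) := by
    simp_rw [charFun_apply, ← MeasurableEquiv.coe_toLp, integral_map_equiv]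
    rw [integral_map hm.aemeasurable (Measurable.aestronglyMeasurable (by fun_prop))]
    simp [hinner, star_mulVec, ← dotProduct_mulVec]
  rw [hchar, charFun_map_toLp_iidCGaussian M hv, charFun_map_toLp_iidCGaussian M hv, hnorm]

/-- On `ℝ`, the moment generating function determines the law as soon as it is finite near `0`. -/
lemma Measure.ext_of_mgf_id_eq {μ ν : Measure ℝ} [IsProbabilityMeasure μ] [IsProbabilityMeasure ν]
    (h : mgf id μ = mgf id ν) (h0 : 0 ∈ interior (integrableExpSet id μ)) : μ = ν := by
  refine Measure.ext_of_charFun (funext fun t ↦ ?_)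
  rw [← complexMGF_id_mul_I, ← complexMGF_id_mul_I]
  exact eqOn_complexMGF_of_mgf h (by simpa using h0)

lemma not_integrableOn_rpow_mul_exp {a c : ℝ} (ha : 1 ≤ a) (hc : 0 ≤ c) :
    ¬ IntegrableOn (fun x : ℝ ↦ x ^ (a - 1) * Real.exp (c * x)) (Set.Ioi 0) := by
  intro h
  have h1 : IntegrableOn (fun _ : ℝ ↦ (1 : ℝ)) (Set.Ioi 1) := by
    refine Integrable.mono (h.mono_set (Set.Ioi_subset_Ioi zero_le_one)) (by fun_prop) ?_
    filter_upwards [ae_restrict_mem measurableSet_Ioi] with x hx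
    have hx1 : (1 : ℝ) ≤ x := le_of_lt hx
    rw [norm_one, Real.norm_of_nonneg (by positivity)]
    exact one_le_mul_of_one_le_of_one_le (Real.one_le_rpow hx1 (by linarith))
      (Real.one_le_exp (by positivity))
  simp [integrableOn_const_iff] at h1

lemma mgf_id_gammaMeasure {a b : ℝ} (ha : 1 ≤ a) (hb : 0 < b) (t : ℝ) :
    mgf id (gammaMeasure a b) t = if t < b then (b / (b - t)) ^ a else 0 := by
  have ha0 : 0 < a := by linarith
  have hint : mgf id (gammaMeasure a b) t
      = b ^ a / Real.Gamma a * ∫ x in Set.Ioi 0, x ^ (a - 1) * Real.exp (-((b - t) * x)) := by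
    rw [mgf, gammaMeasure, integral_withDensity_eq_integral_toReal_smul (f := gammaPDF a b)
      (measurable_gammaPDFReal a b).ennreal_ofReal (ae_of_all _ fun _ ↦ ENNReal.ofReal_lt_top), ← integral_const_mul,
      ← integral_Ici_eq_integral_Ioi, ← integral_indicator measurableSet_Ici]
    congr with x
    rw [gammaPDF, ENNReal.toReal_ofReal (gammaPDFReal_nonneg ha0 hb x), gammaPDFReal]
    by_cases hx : 0 ≤ x
    · have : Real.exp (-((b - t) * x)) = Real.exp (-(b * x)) * Real.exp (t * x) := by
        rw [← Real.exp_add]; ring_nf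
      simp [hx, this]
      ring
    · simp [hx]
  rw [hint]
  split_ifs with ht
  · have hbt : 0 < b - t := by linarith
    have := (Real.Gamma_pos_of_pos ha0).ne'
    rw [Real.integral_rpow_mul_exp_neg_mul_Ioi ha0 hbt, Real.div_rpow zero_le_one hbt.le,
      Real.div_rpow hb.le hbt.le, Real.one_rpow]
    field_simp
  · rw [integral_undef, mul_zero]
    have := not_integrableOn_rpow_mul_exp ha (c := t - b) (by linarith)
    simpa [IntegrableOn, ← neg_mul] using this

lemma integral_exp_mul_sq_gaussianReal {b : ℝ} (hb : 0 < b) (t : ℝ) :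
    ∫ x, Real.exp (t * x ^ 2) ∂(gaussianReal 0 (1 / b / 2).toNNReal) = √(b / (b - t)) := by
  have hv : (1 / b / 2).toNNReal ≠ 0 := by
    rw [ne_eq, Real.toNNReal_eq_zero, not_le]; positivity
  have key (x : ℝ) : gaussianPDFReal 0 (1 / b / 2).toNNReal x • Real.exp (t * x ^ 2)
      = √(b / Real.pi) * Real.exp (-(b - t) * x ^ 2) := by
    rw [gaussianPDFReal, Real.coe_toNNReal _ (by positivity), smul_eq_mul, mul_assoc,
      ← Real.exp_add, ← Real.sqrt_inv]
    congr 2 <;> (field_simp; try ring)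
  rw [integral_gaussianReal_eq_integral_smul hv]
  simp_rw [key]
  rw [integral_const_mul, integral_gaussian, ← Real.sqrt_mul (by positivity)]
  congr 1
  field_simp

lemma integral_exp_mul_norm_sq_stdCGaussian {b : ℝ} (hb : 0 < b) (t : ℝ) :
    ∫ z, Real.exp (t * ‖z‖ ^ 2) ∂(stdCGaussian (1 / b)) = if t < b then b / (b - t) else 0 := by
  have key (p : ℝ × ℝ) : Real.exp (t * ‖(⟨p.1, p.2⟩ : ℂ)‖ ^ 2)
      = Real.exp (t * p.1 ^ 2) * Real.exp (t * p.2 ^ 2) := by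
    rw [← Real.exp_add, ← Complex.normSq_eq_norm_sq, Complex.normSq_mk]
    ring_nf
  rw [integral_stdCGaussian_eq_integral_prod]
  simp_rw [key]
  rw [integral_prod_mul (fun x : ℝ ↦ Real.exp (t * x ^ 2)) (fun y : ℝ ↦ Real.exp (t * y ^ 2)),
    integral_exp_mul_sq_gaussianReal hb]
  split_ifs with ht
  · have hbt : 0 < b - t := by linarith
    exact Real.mul_self_sqrt (by positivity)
  · rw [Real.sqrt_eq_zero_of_nonpos (div_nonpos_of_nonneg_of_nonpos hb.le (by linarith)), mul_zero]

/-- A sum of squared moduli of `r ≥ 1` of the coordinates of an i.i.d. complex Gaussian vector is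
Gamma distributed with shape `r`. -/
lemma iidCGaussian_map_sum_norm_sq {M : ℕ} {b : ℝ} (hb : 0 < b) (S : Finset (Fin M))
    (hS : 1 ≤ S.card) :
    (iidCGaussian M (1 / b)).map (fun x ↦ ∑ i ∈ S, ‖x i‖ ^ 2) = gammaMeasure S.card b := by
  have ha : (1 : ℝ) ≤ S.card := by exact_mod_cast hS
  have := isProbabilityMeasure_gammaMeasure (zero_lt_one.trans_le ha) hb
  have hm : Measurable fun x : Fin M → ℂ ↦ ∑ i ∈ S, ‖x i‖ ^ 2 := by fun_prop
  have := Measure.isProbabilityMeasure_map (μ := iidCGaussian M (1 / b)) hm.aemeasurable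
  symm
  refine Measure.ext_of_mgf_id_eq (funext fun t ↦ ?_) ?_
  · rw [mgf_id_gammaMeasure ha hb, mgf_id_map hm.aemeasurable, mgf]
    have key (x : Fin M → ℂ) : Real.exp (t * ∑ i ∈ S, ‖x i‖ ^ 2)
        = ∏ i, if i ∈ S then Real.exp (t * ‖x i‖ ^ 2) else 1 := by
      rw [Finset.mul_sum, Real.exp_sum, Finset.prod_ite_mem, Finset.univ_inter]
    have hfac (i : Fin M) :
        ∫ z, (if i ∈ S then Real.exp (t * ‖z‖ ^ 2) else 1) ∂(stdCGaussian (1 / b))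
          = if i ∈ S then (if t < b then b / (b - t) else 0) else 1 := by
      by_cases hi : i ∈ S
      · simp only [hi, if_true]
        exact integral_exp_mul_norm_sq_stdCGaussian hb t
      · simp [hi]
    simp_rw [key]
    rw [iidCGaussian, integral_fintype_prod_eq_prod
      (f := fun i (z : ℂ) ↦ if i ∈ S then Real.exp (t * ‖z‖ ^ 2) else 1)]
    simp_rw [hfac]
    rw [Finset.prod_ite_mem, Finset.univ_inter, Finset.prod_const]
    split_ifs
    · rw [Real.rpow_natCast]
    · rw [zero_pow (by omega)]
  · refine mem_interior.2 ⟨Set.Iio b, fun t ht ↦ ?_, isOpen_Iio, hb⟩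
    have hbt : 0 < b - t := sub_pos.2 ht
    refine Integrable.of_integral_ne_zero ?_
    have h := mgf_id_gammaMeasure ha hb t
    rw [if_pos (Set.mem_Iio.1 ht), mgf] at h
    rw [h]
    positivity

lemma Matrix.IsHermitian.eigenvalues_eq_zero_or_one_of_isIdempotentElem {n : Type*} [Fintype n]
    [DecidableEq n] {P : Matrix n n ℂ} (hP : P.IsHermitian) (h : IsIdempotentElem P) (i : n) :
    hP.eigenvalues i = 0 ∨ hP.eigenvalues i = 1 := by
  have := IsIdempotentElem.spectrum_subset ℝ h (hP.eigenvalues_mem_spectrum_real i)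
  simpa using this

/-- The quadratic form of an orthogonal projection, in coordinates with respect to an
eigenbasis. -/
lemma Matrix.IsHermitian.star_dotProduct_mulVec_eq_sum_norm_sq {n : Type*} [Fintype n]
    [DecidableEq n] {P : Matrix n n ℂ} (hP : P.IsHermitian) (h : IsIdempotentElem P) (x : n → ℂ) :
    star x ⬝ᵥ P *ᵥ x = ((∑ i with hP.eigenvalues i ≠ 0,
      ‖((hP.eigenvectorUnitary : Matrix n n ℂ)ᴴ *ᵥ x) i‖ ^ 2 : ℝ) : ℂ) := by
  set U : Matrix n n ℂ := hP.eigenvectorUnitary.1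
  have hspec : P = U * diagonal (RCLike.ofReal ∘ hP.eigenvalues) * Uᴴ := by
    conv_lhs => rw [hP.spectral_theorem, Unitary.conjStarAlgAut_apply]
    rfl
  have hquad : star x ⬝ᵥ P *ᵥ x = star (Uᴴ *ᵥ x) ⬝ᵥ
      diagonal (RCLike.ofReal ∘ hP.eigenvalues) *ᵥ (Uᴴ *ᵥ x) := by
    conv_lhs => rw [hspec]
    rw [star_mulVec, conjTranspose_conjTranspose, ← dotProduct_mulVec, mulVec_mulVec,
      mulVec_mulVec]
  rw [hquad, dotProduct, Finset.sum_filter]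
  push_cast
  refine Finset.sum_congr rfl fun i _ ↦ ?_
  rw [mulVec_diagonal]
  rcases hP.eigenvalues_eq_zero_or_one_of_isIdempotentElem h i with hi | hi
  · simp [hi]
  · simp [hi, ← Complex.conj_mul']

/-- If P is a fixed Hermitian idempotent (orthogonal projection) matrix of rank r and h has
i.i.d. CN(0,s²) entries, then hᴴPh is almost surely a nonnegative real number and its law is
the Gamma distribution with shape r and scale s² (i.e. rate 1/s²). -/
theorem quadratic_form_projection_gamma
    {Ω : Type*} [MeasurableSpace Ω] (μ : Measure Ω) [IsProbabilityMeasure μ]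
    (M r : ℕ) (hM : 1 ≤ M) (hr : 1 ≤ r) (hrM : r ≤ M) (s : ℝ) (hs : 0 < s)
    (P : Matrix (Fin M) (Fin M) ℂ) (hherm : P.IsHermitian) (hidem : P * P = P)
    (hrank : P.rank = r)
    (h : Ω → Fin M → ℂ) (hmeas : Measurable h)
    (hlaw : Measure.map h μ = iidCGaussian M (s ^ 2)) :
    (∀ᵐ ω ∂μ, (star (h ω) ⬝ᵥ P.mulVec (h ω)).im = 0 ∧
        0 ≤ (star (h ω) ⬝ᵥ P.mulVec (h ω)).re) ∧
      Measure.map (fun ω => (star (h ω) ⬝ᵥ P.mulVec (h ω)).re) μ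
        = gammaMeasure r (1 / s ^ 2) := by

  have hquad (x : Fin M → ℂ) := hherm.star_dotProduct_mulVec_eq_sum_norm_sq hidem x
  set U : Matrix (Fin M) (Fin M) ℂ := hherm.eigenvectorUnitary.1
  refine ⟨ae_of_all _ fun ω ↦ ?_, ?_⟩
  · rw [hquad, Complex.ofReal_im, Complex.ofReal_re]
    exact ⟨rfl, by positivity⟩
  have hUH : Uᴴ ∈ Matrix.unitaryGroup (Fin M) ℂ :=
    Unitary.star_mem hherm.eigenvectorUnitary.2
  have hm : Measurable (Uᴴ *ᵥ · : (Fin M → ℂ) → Fin M → ℂ) :=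
    Continuous.measurable (by fun_prop)
  have hcard : (Finset.univ.filter fun i ↦ hherm.eigenvalues i ≠ 0).card = r := by
    rw [← hrank, hherm.rank_eq_card_non_zero_eigs, Fintype.card_subtype]
  have hgamma := iidCGaussian_map_sum_norm_sq (b := 1 / s ^ 2) (by positivity)
    (Finset.univ.filter fun i ↦ hherm.eigenvalues i ≠ 0) (hcard.symm ▸ hr)
  rw [hcard, one_div_one_div, ← iidCGaussian_map_mulVec (by positivity) hUH, ← hlaw,
    Measure.map_map (by fun_prop) hm, Measure.map_map (by fun_prop) hmeas] at hgamma
  rw [← hgamma]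
  congr 1
  ext ω
  rw [hquad, Complex.ofReal_re]
  rfl
end
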